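/- arXiv:1410.7036 — 5 statements merged into one kernel-verified Lean document; each statement's English description precedes it below -/
import Mathlib

section
/- γ - ln(4π) + 2 = Σ_{n=3}^∞ (2·N₁(n) + 3)/(2n(2n+1)(2n+2)), where γ is the Euler–Mascheroni constant and N₁(n) is the number of ones in the binary expansion of n. -/
/-- The number of ones in the binary expansion of `n`. -/
def binaryOnes (n : ℕ) : ℕ := (Nat.digits 2 n).count 1

theorem binaryOnes_zero : binaryOnes 0 = 0 := by simp [binaryOnes]

theorem binaryOnes_two_mul (n : ℕ) : binaryOnes (2 * n) = binaryOnes n := by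
  rcases Nat.eq_zero_or_pos n with rfl | hn
  · rfl
  · have h := Nat.digits_add 2 one_lt_two 0 n two_pos (Or.inr hn.ne')
    rw [zero_add] at h
    simp [binaryOnes, h]

theorem binaryOnes_two_mul_add_one (n : ℕ) : binaryOnes (2 * n + 1) = binaryOnes n + 1 := by
  have h := Nat.digits_add 2 one_lt_two 1 n one_lt_two (Or.inl one_ne_zero)
  rw [add_comm] at h
  rw [binaryOnes, h, List.count_cons_self, binaryOnes]

theorem binaryOnes_le (n : ℕ) : binaryOnes n ≤ n := by
  induction n using Nat.strong_induction_on with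
  | _ n ih =>
    obtain ⟨k, rfl | rfl⟩ := Nat.even_or_odd' n
    · rcases Nat.eq_zero_or_pos k with rfl | hk
      · simp [binaryOnes]
      · rw [binaryOnes_two_mul]
        linarith [ih k (by lia)]
    · rw [binaryOnes_two_mul_add_one]
      linarith [ih k (by lia)]

/-- Twice the error of the trapezoidal rule for `∫ x in n..n+1, 1 / x`. -/
noncomputable def trapezoidError (n : ℕ) : ℝ :=
  1 / (n : ℝ) + 1 / ((n : ℝ) + 1) - 2 * (Real.log ((n : ℝ) + 1) - Real.log n)

theorem trapezoidError_nonneg {n : ℕ} (hn : n ≠ 0) : 0 ≤ trapezoidError n := by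
  have h0 : (0 : ℝ) < n := by positivity
  have hx : (1 : ℝ) ≤ ((n : ℝ) + 1) / n := by rw [le_div_iff₀ h0]; linarith
  have h := Real.self_le_sinh_iff.2 (Real.log_nonneg hx)
  rw [Real.sinh_log (by positivity), Real.log_div (by positivity) h0.ne'] at h
  have he : (((n : ℝ) + 1) / n - (((n : ℝ) + 1) / n)⁻¹) / 2
      = (1 / (n : ℝ) + 1 / ((n : ℝ) + 1)) / 2 := by
    field_simp
    ring
  rw [he] at h
  unfold trapezoidError
  linarith

theorem trapezoidError_le {n : ℕ} (hn : n ≠ 0) :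
    trapezoidError n ≤ 1 / ((n : ℝ) * (n + 1) * (2 * n + 1)) := by
  have h0 : (0 : ℝ) < n := by positivity
  have h := Real.le_log_one_add_of_nonneg (x := 1 / (n : ℝ)) (by positivity)
  have hx : 1 + 1 / (n : ℝ) = ((n : ℝ) + 1) / n := by field_simp
  rw [hx, Real.log_div (by positivity) h0.ne'] at h
  have he : 1 / ((n : ℝ) * (n + 1) * (2 * n + 1))
      = 1 / (n : ℝ) + 1 / ((n : ℝ) + 1) - 2 * (2 * (1 / (n : ℝ)) / (1 / (n : ℝ) + 2)) := by
    field_simp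
    ring
  rw [he]
  unfold trapezoidError
  linarith

theorem trapezoidError_sub_halves {n : ℕ} (hn : n ≠ 0) :
    trapezoidError n - (trapezoidError (2 * n) + trapezoidError (2 * n + 1))
      = 2 / (2 * (n : ℝ) * (2 * n + 1) * (2 * n + 2)) := by
  have h0 : (0 : ℝ) < n := by positivity
  have h1 : Real.log (2 * (n : ℝ)) = Real.log 2 + Real.log n :=
    Real.log_mul two_ne_zero h0.ne'
  have h2 : Real.log (2 * (n : ℝ) + 1 + 1) = Real.log 2 + Real.log (n + 1) := by
    rw [← Real.log_mul two_ne_zero (by positivity)]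
    ring_nf
  unfold trapezoidError
  push_cast
  rw [h1, h2]
  field_simp
  ring

theorem sum_range_trapezoidError_odd (N : ℕ) :
    ∑ i ∈ Finset.range N, trapezoidError (2 * i + 1)
      = ((harmonic (2 * N) : ℚ) - Real.log ((2 * N : ℕ) + 1)) - Real.log (Real.Wallis.W N) := by
  induction N with
  | zero => simp [Real.Wallis.W]
  | succ N ih =>
    have hW := Real.Wallis.W_pos N
    rw [Finset.sum_range_succ, ih, Real.Wallis.W_succ, Real.log_mul hW.ne' (by positivity),
      Real.log_mul (by positivity) (by positivity), Real.log_div (by positivity) (by positivity),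
      Real.log_div (by positivity) (by positivity), show 2 * (N + 1) = 2 * N + 1 + 1 by ring,
      harmonic_succ, harmonic_succ]
    unfold trapezoidError
    push_cast
    ring_nf

theorem trapezoidError_one : trapezoidError 1 = 3 / 2 - 2 * Real.log 2 := by
  norm_num [trapezoidError]

theorem summable_trapezoidError_odd : Summable fun n : ℕ ↦ trapezoidError (2 * n + 1) := by
  have hs : Summable fun n : ℕ ↦ 1 / ((n + 1 : ℕ) : ℝ) ^ 2 :=
    (summable_nat_add_iff 1).2 (Real.summable_one_div_nat_pow.2 one_lt_two)
  refine Summable.of_nonneg_of_le (fun n ↦ trapezoidError_nonneg (by lia))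
    (fun n ↦ (trapezoidError_le (by lia)).trans ?_) hs
  push_cast
  gcongr
  have h0 : (0 : ℝ) ≤ n := by positivity
  nlinarith [mul_nonneg h0 h0, mul_nonneg (mul_nonneg h0 h0) h0]

theorem hasSum_trapezoidError_odd :
    HasSum (fun n : ℕ ↦ trapezoidError (2 * n + 1))
      (Real.eulerMascheroniConstant - Real.log (Real.pi / 2)) := by
  rw [summable_trapezoidError_odd.hasSum_iff_tendsto_nat]
  simp_rw [sum_range_trapezoidError_odd]
  refine Filter.Tendsto.sub ?_ (Real.Wallis.tendsto_W_nhds_pi_div_two.log (by positivity))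
  exact Real.tendsto_harmonic_sub_log_add_one.comp
    (Filter.tendsto_id.const_mul_atTop' (two_pos : 0 < 2))

/-- `N₁(n) + 3/2` for positive `n`, and `0` at `0`. -/
noncomputable def onesWeight (n : ℕ) : ℝ := binaryOnes n + if n = 0 then 0 else 3 / 2

theorem onesWeight_zero : onesWeight 0 = 0 := by simp [onesWeight, binaryOnes_zero]

theorem onesWeight_two_mul (n : ℕ) : onesWeight (2 * n) = onesWeight n := by
  simp [onesWeight, binaryOnes_two_mul]

theorem onesWeight_two_mul_add_one (n : ℕ) :
    onesWeight (2 * n + 1) = onesWeight n + 1 + if n = 0 then 3 / 2 else 0 := by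
  simp only [onesWeight, binaryOnes_two_mul_add_one]
  split_ifs <;> first | lia | (push_cast; ring)

theorem onesWeight_nonneg (n : ℕ) : 0 ≤ onesWeight n := by
  unfold onesWeight
  positivity

theorem onesWeight_le (n : ℕ) : onesWeight n ≤ 5 / 2 * n := by
  rcases Nat.eq_zero_or_pos n with rfl | hn
  · simp [onesWeight_zero]
  · have h : (binaryOnes n : ℝ) ≤ n := mod_cast binaryOnes_le n
    have h1 : (1 : ℝ) ≤ n := mod_cast hn
    rw [onesWeight, if_neg hn.ne']
    linarith

theorem summable_onesWeight_mul_trapezoidError :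
    Summable fun n ↦ onesWeight n * trapezoidError n := by
  have hs : Summable fun n : ℕ ↦ 5 / 2 * (1 / (n : ℝ) ^ 2) :=
    (Real.summable_one_div_nat_pow.2 one_lt_two).mul_left _
  refine Summable.of_nonneg_of_le (fun n ↦ ?_) (fun n ↦ ?_) hs
  · rcases eq_or_ne n 0 with rfl | hn
    · simp [onesWeight_zero]
    · exact mul_nonneg (onesWeight_nonneg n) (trapezoidError_nonneg hn)
  · rcases eq_or_ne n 0 with rfl | hn
    · simp [onesWeight_zero]
    · have h0 : (0 : ℝ) < n := by positivity
      calc onesWeight n * trapezoidError n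
          ≤ 5 / 2 * n * (1 / ((n : ℝ) * (n + 1) * (2 * n + 1))) :=
            mul_le_mul (onesWeight_le n) (trapezoidError_le hn) (trapezoidError_nonneg hn)
              (by positivity)
        _ = 5 / 2 * (1 / (((n : ℝ) + 1) * (2 * n + 1))) := by field_simp
        _ ≤ 5 / 2 * (1 / (n : ℝ) ^ 2) := by
            gcongr
            nlinarith

theorem hasSum_onesWeight_mul :
    HasSum (fun n : ℕ ↦ onesWeight n * (2 / (2 * (n : ℝ) * (2 * n + 1) * (2 * n + 2))))
      (Real.eulerMascheroniConstant - Real.log (4 * Real.pi) + 9 / 4) := by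
  have hF := summable_onesWeight_mul_trapezoidError
  have hE := (hF.comp_injective (mul_right_injective₀ (two_ne_zero (α := ℕ)))).hasSum
  have hO := (hF.comp_injective
    ((add_left_injective 1).comp (mul_right_injective₀ (two_ne_zero (α := ℕ))))).hasSum
  have hEO := hF.hasSum.unique (hE.even_add_odd hO)
  have hI := hasSum_ite_eq (0 : ℕ) (3 / 2 * trapezoidError 1)
  have h := (hF.hasSum.sub (hE.add hO)).add (hasSum_trapezoidError_odd.add hI)
  rw [← hEO, sub_self, zero_add, trapezoidError_one] at h
  have hv : Real.eulerMascheroniConstant - Real.log (4 * Real.pi) + 9 / 4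
      = Real.eulerMascheroniConstant - Real.log (Real.pi / 2)
        + 3 / 2 * (3 / 2 - 2 * Real.log 2) := by
    rw [Real.log_mul (by norm_num) Real.pi_ne_zero, Real.log_div Real.pi_ne_zero two_ne_zero,
      show (4 : ℝ) = 2 ^ 2 by norm_num, Real.log_pow]
    push_cast
    ring
  rw [hv]
  refine h.congr_fun fun n ↦ ?_
  simp only [Function.comp_apply, onesWeight_two_mul, onesWeight_two_mul_add_one]
  rcases eq_or_ne n 0 with rfl | hn
  · norm_num [onesWeight_zero, trapezoidError_one]
    ring
  · rw [← trapezoidError_sub_halves hn, if_neg hn, if_neg hn]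
    ring

/-- `γ - ln(4π) + 2 = Σ_{n≥3} (2·N₁(n)+3)/(2n(2n+1)(2n+2))`. -/
theorem euler_log_four_pi_series :
    Real.eulerMascheroniConstant - Real.log (4 * Real.pi) + 2 =
      ∑' n : ℕ, (2 * ((Nat.digits 2 (n + 3)).count 1 : ℝ) + 3) /
        (2 * (n + 3 : ℝ) * (2 * (n + 3 : ℝ) + 1) * (2 * (n + 3 : ℝ) + 2)) := by
  have h := (hasSum_nat_add_iff' 3).2 hasSum_onesWeight_mul
  have h1 : onesWeight 1 = 5 / 2 := by norm_num [onesWeight, binaryOnes]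
  have h2 : onesWeight 2 = 5 / 2 := by norm_num [onesWeight, binaryOnes]
  simp only [Finset.sum_range_succ, Finset.sum_range_zero, onesWeight_zero, h1, h2] at h
  refine Eq.trans ?_ (h.tsum_eq.symm.trans (tsum_congr fun n ↦ ?_))
  · norm_num
    ring
  · rw [onesWeight, if_neg (by lia), binaryOnes]
    push_cast
    ring
end

section
/- Addison's series for the Euler constant: γ = 1/2 + Σ_{n=1}^∞ (N₁(n) + N₀(n))/(2n(2n+1)(2n+2)), where γ is the Euler–Mascheroni constant, N₁(n) is the number of ones and N₀(n) the number of zeros in the binary expansion of n. -/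
open Filter Topology Finset

lemma List.count_one_add_count_zero {l : List ℕ} (hl : ∀ d ∈ l, d < 2) :
    l.count 1 + l.count 0 = l.length := by
  induction l with
  | nil => rfl
  | cons a l ih =>
    have ha := hl a (by simp)
    have ih' := ih fun d hd => hl d (by simp [hd])
    interval_cases a <;> simp <;> omega

lemma Nat.count_one_add_count_zero_digits_two {n : ℕ} (hn : n ≠ 0) :
    (Nat.digits 2 n).count 1 + (Nat.digits 2 n).count 0 = Nat.log 2 n + 1 := by
  rw [List.count_one_add_count_zero fun d hd => Nat.digits_lt_base one_lt_two hd,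
    Nat.length_digits 2 n one_lt_two hn]

lemma sum_range_inv_mul_mul (N : ℕ) :
    ∑ n ∈ range N, 1 / (2 * (n + 1 : ℝ) * (2 * (n + 1 : ℝ) + 1) * (2 * (n + 1 : ℝ) + 2)) =
      harmonic N - harmonic (2 * N + 1) + 3 / 4 + 1 / (4 * (N + 1)) := by
  induction N with
  | zero => norm_num [harmonic_succ]
  | succ N ih =>
    rw [sum_range_succ, ih, show 2 * (N + 1) + 1 = 2 * N + 1 + 1 + 1 by ring]
    simp only [harmonic_succ]
    push_cast
    field_simp
    ring

/-- The partial sum of Addison's series over all `n < 2 ^ k`. -/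
lemma sum_range_two_pow_sub_one_log (k : ℕ) :
    ∑ n ∈ range (2 ^ k - 1), ((Nat.log 2 (n + 1) : ℝ) + 1) /
        (2 * (n + 1 : ℝ) * (2 * (n + 1 : ℝ) + 1) * (2 * (n + 1 : ℝ) + 2)) =
      harmonic (2 ^ k - 1) - k * (harmonic (2 ^ (k + 1) - 1) - harmonic (2 ^ k - 1))
        - 1 / 2 + (1 / 2) * (1 / 2) ^ k + k * (1 / 2) ^ k / 4 := by
  induction k with
  | zero => norm_num
  | succ k ih =>
    have hpos : 1 ≤ 2 ^ k := Nat.one_le_two_pow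
    have hle : 2 ^ k - 1 ≤ 2 ^ (k + 1) - 1 := by rw [pow_succ]; omega
    have hblock : ∑ n ∈ Ico (2 ^ k - 1 : ℕ) (2 ^ (k + 1) - 1), ((Nat.log 2 (n + 1) : ℝ) + 1) /
          (2 * (n + 1 : ℝ) * (2 * (n + 1 : ℝ) + 1) * (2 * (n + 1 : ℝ) + 2)) =
        (k + 1) * ∑ n ∈ Ico (2 ^ k - 1 : ℕ) (2 ^ (k + 1) - 1),
          1 / (2 * (n + 1 : ℝ) * (2 * (n + 1 : ℝ) + 1) * (2 * (n + 1 : ℝ) + 2)) := by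
      rw [mul_sum]
      refine sum_congr rfl fun n hn => ?_
      rw [mem_Ico] at hn
      rw [Nat.log_eq_of_pow_le_of_lt_pow (m := k) (by omega) (by omega), mul_one_div]
    have hdouble : ∀ j : ℕ, 2 * (2 ^ j - 1) + 1 = 2 ^ (j + 1) - 1 := fun j => by
      have : 1 ≤ 2 ^ j := Nat.one_le_two_pow
      rw [pow_succ]
      omega
    have hcast : ∀ j : ℕ, 1 / (4 * (((2 ^ j - 1 : ℕ) : ℝ) + 1)) = (1 / 2) ^ j / 4 := fun j => by
      rw [Nat.cast_sub Nat.one_le_two_pow]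
      push_cast
      rw [sub_add_cancel, one_div_pow]
      field_simp
    rw [← sum_range_add_sum_Ico _ hle, ih, hblock, sum_Ico_eq_sub _ hle,
      sum_range_inv_mul_mul, sum_range_inv_mul_mul, hdouble, hdouble, hcast, hcast]
    push_cast
    ring

lemma eulerMascheroniSeq_two_pow_sub_one (k : ℕ) :
    Real.eulerMascheroniSeq (2 ^ k - 1) = harmonic (2 ^ k - 1) - k * Real.log 2 := by
  rw [Real.eulerMascheroniSeq, Nat.cast_sub Nat.one_le_two_pow]
  simp

lemma eulerMascheroniConstant_sub_lt (k : ℕ) :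
    Real.eulerMascheroniConstant - (1 / 2) ^ k < harmonic (2 ^ k - 1) - k * Real.log 2 := by
  have h := Real.eulerMascheroniConstant_lt_eulerMascheroniSeq' (2 ^ k)
  have hs : harmonic (2 ^ k) = harmonic (2 ^ k - 1) + ((2 : ℚ) ^ k)⁻¹ := by
    conv_lhs => rw [← Nat.sub_add_cancel (Nat.one_le_two_pow (n := k)), harmonic_succ]
    rw [Nat.sub_add_cancel Nat.one_le_two_pow]
    push_cast
    rfl
  rw [Real.eulerMascheroniSeq', if_neg (by positivity), hs] at h
  push_cast at h
  rw [Real.log_pow] at h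
  rw [one_div_pow, one_div]
  linarith

lemma tendsto_nat_mul_half_pow :
    Tendsto (fun k : ℕ => (k : ℝ) * (1 / 2) ^ k) atTop (𝓝 0) :=
  tendsto_self_mul_const_pow_of_lt_one (by norm_num) (by norm_num)

lemma tendsto_nat_mul_harmonic_two_pow :
    Tendsto (fun k : ℕ => (k : ℝ) *
      ((harmonic (2 ^ (k + 1) - 1) - harmonic (2 ^ k - 1) : ℝ) - Real.log 2)) atTop (𝓝 0) := by
  refine squeeze_zero_norm (fun k => ?_) tendsto_nat_mul_half_pow
  have h₁ := eulerMascheroniConstant_sub_lt k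
  have h₂ := Real.eulerMascheroniSeq_lt_eulerMascheroniConstant (2 ^ k - 1)
  have h₃ := eulerMascheroniConstant_sub_lt (k + 1)
  have h₄ := Real.eulerMascheroniSeq_lt_eulerMascheroniConstant (2 ^ (k + 1) - 1)
  rw [eulerMascheroniSeq_two_pow_sub_one] at h₂ h₄
  have hp : (0 : ℝ) < (1 / 2) ^ k := by positivity
  rw [pow_succ] at h₃
  push_cast at h₃ h₄
  rw [norm_mul, Real.norm_natCast, Real.norm_eq_abs]
  gcongr
  rw [abs_le]
  constructor <;> linarith

lemma tendsto_sum_range_two_pow_sub_one_log :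
    Tendsto (fun k : ℕ => ∑ n ∈ range (2 ^ k - 1), ((Nat.log 2 (n + 1) : ℝ) + 1) /
        (2 * (n + 1 : ℝ) * (2 * (n + 1 : ℝ) + 1) * (2 * (n + 1 : ℝ) + 2)))
      atTop (𝓝 (Real.eulerMascheroniConstant - 1 / 2)) := by
  have hhalf : Tendsto (fun k : ℕ => (1 / 2 : ℝ) ^ k) atTop (𝓝 0) :=
    tendsto_pow_atTop_nhds_zero_of_lt_one (by norm_num) (by norm_num)
  have hγ : Tendsto (fun k : ℕ => (harmonic (2 ^ k - 1) : ℝ) - k * Real.log 2) atTop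
      (𝓝 Real.eulerMascheroniConstant) := by
    refine tendsto_of_tendsto_of_tendsto_of_le_of_le
      (by simpa using tendsto_const_nhds.sub hhalf) tendsto_const_nhds
      (fun k => (eulerMascheroniConstant_sub_lt k).le) fun k => ?_
    have h := Real.eulerMascheroniSeq_lt_eulerMascheroniConstant (2 ^ k - 1)
    rw [eulerMascheroniSeq_two_pow_sub_one] at h
    exact h.le
  have h := (((hγ.sub tendsto_nat_mul_harmonic_two_pow).sub_const (1 / 2)).add
    (hhalf.const_mul (1 / 2))).add (tendsto_nat_mul_half_pow.div_const 4)
  simp only [sub_zero, mul_zero, add_zero, zero_div] at h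
  refine h.congr fun k => ?_
  rw [sum_range_two_pow_sub_one_log]
  ring

lemma hasSum_log_two_div :
    HasSum (fun n : ℕ => ((Nat.log 2 (n + 1) : ℝ) + 1) /
        (2 * (n + 1 : ℝ) * (2 * (n + 1 : ℝ) + 1) * (2 * (n + 1 : ℝ) + 2)))
      (Real.eulerMascheroniConstant - 1 / 2) := by
  rw [hasSum_iff_tendsto_nat_of_nonneg fun n => by positivity]
  refine (tendsto_iff_tendsto_subseq_of_monotone (φ := fun k : ℕ => 2 ^ k - 1) ?_ ?_).2
    tendsto_sum_range_two_pow_sub_one_log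
  · exact monotone_nat_of_le_succ fun N => by
      rw [sum_range_succ]
      exact le_add_of_nonneg_right (by positivity)
  · exact (tendsto_sub_atTop_nat 1).comp (tendsto_pow_atTop_atTop_of_one_lt one_lt_two)

/-- Addison's series: `γ = 1/2 + Σ_{n≥1} (N₁(n)+N₀(n))/(2n(2n+1)(2n+2))`. -/
theorem addison_series :
    Real.eulerMascheroniConstant =
      1 / 2 + ∑' n : ℕ,
        (((Nat.digits 2 (n + 1)).count 1 : ℝ) + ((Nat.digits 2 (n + 1)).count 0 : ℝ)) /
          (2 * (n + 1 : ℝ) * (2 * (n + 1 : ℝ) + 1) * (2 * (n + 1 : ℝ) + 2)) := by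
  have hdigits : ∀ n : ℕ, ((Nat.digits 2 (n + 1)).count 1 : ℝ) +
      ((Nat.digits 2 (n + 1)).count 0 : ℝ) = (Nat.log 2 (n + 1) : ℝ) + 1 := fun n => by
    exact_mod_cast Nat.count_one_add_count_zero_digits_two n.succ_ne_zero
  simp_rw [hdigits]
  rw [hasSum_log_two_div.tsum_eq]
  ring
end

section
/- ln(4/π) = Σ_{n=1}^∞ (N₁(n) - N₀(n))/(2n(2n+1)), where N₁(n) is the number of ones and N₀(n) the number of zeros in the binary expansion of n. -/
open Filter Topology

/-- Ones minus zeros in the binary expansion of `n`. -/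
def binaryExcess (n : ℕ) : ℤ :=
  ((Nat.digits 2 n).count 1 : ℤ) - ((Nat.digits 2 n).count 0 : ℤ)

lemma binaryExcess_zero : binaryExcess 0 = 0 := by simp [binaryExcess]

lemma binaryExcess_two_mul {n : ℕ} (hn : n ≠ 0) :
    binaryExcess (2 * n) = binaryExcess n - 1 := by
  unfold binaryExcess
  rw [Nat.digits_def' (by norm_num) (by lia : 0 < 2 * n), Nat.mul_mod_right,
    Nat.mul_div_cancel_left n two_pos]
  simp
  ring

lemma binaryExcess_two_mul_add_one (n : ℕ) :
    binaryExcess (2 * n + 1) = binaryExcess n + 1 := by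
  unfold binaryExcess
  rw [Nat.digits_def' (by norm_num) (by lia : 0 < 2 * n + 1),
    (by lia : (2 * n + 1) % 2 = 1), (by lia : (2 * n + 1) / 2 = n)]
  simp
  ring

lemma abs_binaryExcess_le (n : ℕ) : |(binaryExcess n : ℝ)| ≤ 3 * √n := by
  induction n using Nat.strong_induction_on with
  | _ n ih =>
    rcases Nat.eq_zero_or_pos (n / 2) with h | h
    · obtain rfl | rfl : n = 0 ∨ n = 1 := by lia
      · simp [binaryExcess]
      · norm_num [binaryExcess]
    · have h1 := ih (n / 2) (by lia)
      set m := n / 2 with hm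
      have hm1 : (1 : ℝ) ≤ m := by exact_mod_cast h
      have hs : 1 ≤ √(m : ℝ) := Real.one_le_sqrt.2 hm1
      have hsq : √(m : ℝ) ^ 2 = m := Real.sq_sqrt (by linarith)
      have hnm : (2 : ℝ) * m ≤ n := by exact_mod_cast (by lia : 2 * m ≤ n)
      have h2 : √(m : ℝ) + 1 / 3 ≤ √n := Real.le_sqrt_of_sq_le (by nlinarith)
      have h3 : |(binaryExcess n : ℝ)| ≤ |(binaryExcess m : ℝ)| + 1 := by
        obtain h4 | h4 : n = 2 * m ∨ n = 2 * m + 1 := by lia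
        · rw [h4, binaryExcess_two_mul h.ne']
          push_cast
          simpa using abs_sub (binaryExcess m : ℝ) 1
        · rw [h4, binaryExcess_two_mul_add_one]
          push_cast
          simpa using abs_add_le (binaryExcess m : ℝ) 1
      linarith

/-- The terms `1 / n - log (1 + 1 / n)` of the series for the Euler–Mascheroni constant. -/
noncomputable def eulerTerm (n : ℕ) : ℝ := 1 / n - Real.log (1 + 1 / n)

lemma eulerTerm_zero : eulerTerm 0 = 0 := by simp [eulerTerm]

lemma eulerTerm_eq {n : ℕ} (hn : n ≠ 0) :
    eulerTerm n = 1 / n - (Real.log (n + 1) - Real.log n) := by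
  have : (n : ℝ) ≠ 0 := by exact_mod_cast hn
  rw [eulerTerm, ← Real.log_div (by positivity) this]
  congr 2
  field_simp

lemma abs_eulerTerm_le (n : ℕ) : |eulerTerm n| ≤ 1 / (n : ℝ) ^ 2 := by
  rcases Nat.eq_zero_or_pos n with rfl | hn
  · simp [eulerTerm_zero]
  have h0 : (0 : ℝ) < n := by exact_mod_cast hn
  have h1 := Real.log_le_sub_one_of_pos (by positivity : (0 : ℝ) < 1 + 1 / n)
  have h2 := Real.one_sub_inv_le_log_of_pos (by positivity : (0 : ℝ) < 1 + 1 / n)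
  have h3 : 1 / (n : ℝ) - (1 - (1 + 1 / (n : ℝ))⁻¹) ≤ 1 / (n : ℝ) ^ 2 := by
    have : 1 / (n : ℝ) - (1 - (1 + 1 / (n : ℝ))⁻¹) = 1 / (n * (n + 1)) := by
      field_simp
      ring
    rw [this]
    gcongr
    nlinarith
  rw [eulerTerm, abs_of_nonneg (by linarith)]
  linarith

lemma summable_eulerTerm : Summable eulerTerm :=
  .of_norm_bounded (Real.summable_one_div_nat_pow.2 one_lt_two) abs_eulerTerm_le

lemma summable_binaryExcess_mul_eulerTerm :
    Summable fun n ↦ (binaryExcess n : ℝ) * eulerTerm n := by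
  refine .of_norm_bounded
    ((Real.summable_one_div_nat_rpow.2 (by norm_num : (1 : ℝ) < 3 / 2)).mul_left 3) fun n ↦ ?_
  rcases Nat.eq_zero_or_pos n with rfl | hn
  · simp [eulerTerm_zero]
  have h0 : (0 : ℝ) < n := by exact_mod_cast hn
  rw [norm_mul]
  refine (mul_le_mul (abs_binaryExcess_le n) (abs_eulerTerm_le n) (abs_nonneg _)
    (by positivity)).trans_eq ?_
  rw [Real.sqrt_eq_rpow, one_div, one_div, one_div, ← Real.rpow_natCast, ← Real.rpow_neg h0.le,
    ← Real.rpow_neg h0.le, mul_assoc, ← Real.rpow_add h0]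
  norm_num

lemma eulerTerm_sub_eulerTerm_sub_eulerTerm {n : ℕ} (hn : n ≠ 0) :
    eulerTerm n - eulerTerm (2 * n) - eulerTerm (2 * n + 1) = 1 / (2 * n * (2 * n + 1)) := by
  have h0 : (n : ℝ) ≠ 0 := by exact_mod_cast hn
  have h1 : Real.log (2 * n + 1 + 1) = Real.log 2 + Real.log (n + 1) := by
    rw [← Real.log_mul (by norm_num) (by positivity)]
    congr 1
    ring
  rw [eulerTerm_eq hn, eulerTerm_eq (by lia), eulerTerm_eq (by lia)]
  push_cast
  rw [h1, Real.log_mul (by norm_num) h0]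
  field_simp
  ring

lemma tendsto_harmonic_two_mul_sub_harmonic :
    Tendsto (fun n : ℕ ↦ (harmonic (2 * n) : ℝ) - harmonic n) atTop (𝓝 (Real.log 2)) := by
  have h := Real.tendsto_harmonic_sub_log
  have h2 := (h.comp (tendsto_id.const_mul_atTop' two_pos)).sub h
  have h3 := h2.add_const (Real.log 2)
  rw [sub_self, zero_add] at h3
  refine h3.congr' ?_
  filter_upwards [eventually_ne_atTop 0] with n hn
  have h0 : (n : ℝ) ≠ 0 := by exact_mod_cast hn
  simp only [Function.comp, id, Nat.cast_mul, Nat.cast_ofNat]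
  rw [Real.log_mul two_ne_zero h0]
  ring

lemma sum_eulerTerm_odd_sub_even (n : ℕ) :
    ∑ k ∈ Finset.range n, (eulerTerm (2 * k + 1) - eulerTerm (2 * (k + 1))) =
      ((harmonic (2 * n) : ℝ) - harmonic n) - Real.log (Real.Wallis.W n) := by
  induction n with
  | zero => simp [Real.Wallis.W]
  | succ n ih =>
    have h1 : (0 : ℝ) < 2 * n + 1 := by positivity
    have h2 : (0 : ℝ) < 2 * n + 2 := by positivity
    have h3 : (0 : ℝ) < 2 * n + 3 := by positivity
    rw [Finset.sum_range_succ, ih, Real.Wallis.W_succ, eulerTerm_eq (by lia),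
      eulerTerm_eq (by lia), Real.log_mul (Real.Wallis.W_pos n).ne' (by positivity),
      Real.log_mul (by positivity) (by positivity), Real.log_div h2.ne' h1.ne',
      Real.log_div h2.ne' h3.ne', mul_add, harmonic_succ, mul_one, harmonic_succ, harmonic_succ]
    push_cast
    rw [(by ring : (2 * n + 1 + 1 : ℝ) = 2 * n + 2), (by ring : (2 * n + 2 + 1 : ℝ) = 2 * n + 3)]
    field_simp
    ring

lemma tsum_eulerTerm_odd_sub_even :
    ∑' k : ℕ, eulerTerm (2 * k + 1) - ∑' k : ℕ, eulerTerm (2 * k) = Real.log (4 / Real.pi) := by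
  have ho : Summable fun k : ℕ ↦ eulerTerm (2 * k + 1) :=
    summable_eulerTerm.comp_injective fun a b h ↦ by simpa using h
  have he : Summable fun k : ℕ ↦ eulerTerm (2 * k) :=
    summable_eulerTerm.comp_injective fun a b h ↦ by simpa using h
  have he' : Summable fun k : ℕ ↦ eulerTerm (2 * (k + 1)) := (summable_nat_add_iff 1).2 he
  rw [he.tsum_eq_zero_add, mul_zero, eulerTerm_zero, zero_add, ← ho.tsum_sub he']
  refine tendsto_nhds_unique (ho.sub he').hasSum.tendsto_sum_nat ?_
  simp_rw [sum_eulerTerm_odd_sub_even]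
  have hpi := Real.pi_pos
  have : Real.log (4 / Real.pi) = Real.log 2 - Real.log (Real.pi / 2) := by
    rw [← Real.log_div two_ne_zero (by positivity)]
    congr 1
    field_simp
    norm_num
  rw [this]
  exact tendsto_harmonic_two_mul_sub_harmonic.sub
    (Real.Wallis.tendsto_W_nhds_pi_div_two.log (by positivity))

lemma hasSum_binaryExcess_div :
    HasSum (fun n : ℕ ↦ (binaryExcess n : ℝ) / (2 * n * (2 * n + 1)))
      (Real.log (4 / Real.pi)) := by
  have hs := summable_binaryExcess_mul_eulerTerm
  have hinj : Function.Injective fun k : ℕ ↦ 2 * k := fun a b h ↦ by simpa using h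
  have hinj' : Function.Injective fun k : ℕ ↦ 2 * k + 1 := fun a b h ↦ by simpa using h
  have hse : Summable fun k : ℕ ↦ (binaryExcess (2 * k) : ℝ) * eulerTerm (2 * k) :=
    hs.comp_injective hinj
  have hso : Summable fun k : ℕ ↦ (binaryExcess (2 * k + 1) : ℝ) * eulerTerm (2 * k + 1) :=
    hs.comp_injective hinj'
  have hfe : Summable fun k : ℕ ↦ eulerTerm (2 * k) := summable_eulerTerm.comp_injective hinj
  have hfo : Summable fun k : ℕ ↦ eulerTerm (2 * k + 1) :=
    summable_eulerTerm.comp_injective hinj'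
  have hsum := (hs.hasSum.sub (hse.hasSum.add hso.hasSum)).add (hfo.hasSum.sub hfe.hasSum)
  rw [tsum_even_add_odd (f := fun n ↦ (binaryExcess n : ℝ) * eulerTerm n) hse hso, sub_self,
    zero_add, tsum_eulerTerm_odd_sub_even] at hsum
  refine (congrArg (HasSum · _) (funext fun n ↦ ?_)).mpr hsum
  rcases eq_or_ne n 0 with rfl | hn
  · simp [binaryExcess_zero, eulerTerm_zero, binaryExcess_two_mul_add_one 0]
  · rw [div_eq_mul_one_div, ← eulerTerm_sub_eulerTerm_sub_eulerTerm hn, binaryExcess_two_mul hn,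
      binaryExcess_two_mul_add_one]
    push_cast
    ring

/-- `ln(4/π) = Σ_{n≥1} (N₁(n)-N₀(n))/(2n(2n+1))`. -/
theorem log_four_div_pi_series :
    Real.log (4 / Real.pi) =
      ∑' n : ℕ,
        ((((Nat.digits 2 (n + 1)).count 1 : ℤ) - ((Nat.digits 2 (n + 1)).count 0 : ℤ) : ℤ) : ℝ) /
          (2 * (n + 1 : ℝ) * (2 * (n + 1 : ℝ) + 1)) := by
  have h := hasSum_binaryExcess_div
  rw [← h.tsum_eq, h.summable.tsum_eq_zero_add, binaryExcess_zero]
  simp [binaryExcess]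
end

section
/- Vacca's series: γ = Σ_{n=2}^∞ (-1)^n · (N₁(⌊n/2⌋) + N₀(⌊n/2⌋))/n, where the sum converges (as a limit of partial sums), γ is the Euler–Mascheroni constant, and N₁(m), N₀(m) are the numbers of ones and zeros in the binary expansion of m. Equivalently, since N₁(⌊n/2⌋) + N₀(⌊n/2⌋) = ⌊log₂ n⌋ for n ≥ 2, γ = Σ_{n=2}^∞ (-1)^n ⌊log₂ n⌋ / n. -/
open Filter

theorem List.count_one_add_count_zero_of_lt_two (l : List ℕ) (h : ∀ d ∈ l, d < 2) :
    l.count 1 + l.count 0 = l.length := by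
  induction l with
  | nil => simp
  | cons a l ih =>
    have ha : a < 2 := h a (by simp)
    have := ih fun d hd => h d (by simp [hd])
    interval_cases a <;> simp <;> omega

theorem Nat.count_digits_two_half (n : ℕ) :
    (Nat.digits 2 (n / 2)).count 1 + (Nat.digits 2 (n / 2)).count 0 = Nat.log 2 n := by
  rw [List.count_one_add_count_zero_of_lt_two _ fun d hd => Nat.digits_lt_base one_lt_two hd]
  rcases lt_or_ge n 2 with hn | hn
  · interval_cases n <;> simp
  · rw [Nat.length_digits 2 _ one_lt_two (by omega), Nat.log_div_base]
    have := Nat.log_pos one_lt_two hn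
    omega

/-- Splitting an alternating sum of `⌊log₂ n⌋ / n` by parity telescopes the logarithms. -/
theorem sum_range_alternating_log_div (M : ℕ) :
    ∑ n ∈ Finset.range (2 * M), (-1 : ℝ) ^ n * (Nat.log 2 n : ℝ) / n =
      ∑ n ∈ Finset.range M, (1 : ℝ) / n - ∑ n ∈ Finset.Ico M (2 * M), (Nat.log 2 n : ℝ) / n := by
  rw [Finset.sum_Ico_eq_sub _ (by omega : M ≤ 2 * M)]
  induction M with
  | zero => simp
  | succ m ih =>
    rw [show 2 * (m + 1) = 2 * m + 1 + 1 by ring]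
    simp only [Finset.sum_range_succ, ih]
    rcases Nat.eq_zero_or_pos m with rfl | hm
    · simp
    · have hlog : Nat.log 2 (2 * m) = Nat.log 2 m + 1 := by
        rw [mul_comm, Nat.log_mul_base one_lt_two hm.ne']
      have hm' : (m : ℝ) ≠ 0 := by positivity
      rw [hlog, Even.neg_one_pow (even_two_mul m), Odd.neg_one_pow (odd_two_mul_add_one m)]
      push_cast
      field_simp
      ring

theorem sum_Ico_log_div {M : ℕ} (hM : M ≠ 0) :
    ∑ n ∈ Finset.Ico M (2 * M), (Nat.log 2 n : ℝ) / n =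
      Nat.log 2 M * ∑ n ∈ Finset.Ico M (2 * M), (1 : ℝ) / n +
        ∑ n ∈ Finset.Ico (2 ^ (Nat.log 2 M + 1)) (2 * M), (1 : ℝ) / n := by
  set k := Nat.log 2 M with hk
  have h₁ : 2 ^ k ≤ M := Nat.pow_log_le_self 2 hM
  have h₂ : M < 2 ^ (k + 1) := Nat.lt_pow_succ_log_self one_lt_two M
  have h₃ : 2 ^ (k + 1) ≤ 2 * M := by rw [pow_succ]; omega
  have h₄ : 2 * M < 2 ^ (k + 2) := by rw [pow_succ]; omega
  rw [← Finset.sum_Ico_consecutive _ h₂.le h₃,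
    ← Finset.sum_Ico_consecutive (fun n : ℕ => (1 : ℝ) / n) h₂.le h₃, mul_add, add_assoc,
    Finset.mul_sum, Finset.mul_sum, ← Finset.sum_add_distrib]
  congr 1
  · refine Finset.sum_congr rfl fun n hn => ?_
    rw [Finset.mem_Ico] at hn
    rw [Nat.log_eq_of_pow_le_of_lt_pow (h₁.trans hn.1) hn.2]
    ring
  · refine Finset.sum_congr rfl fun n hn => ?_
    rw [Finset.mem_Ico] at hn
    rw [Nat.log_eq_of_pow_le_of_lt_pow hn.1 (hn.2.trans h₄)]
    push_cast
    ring

theorem sum_range_alternating_log_div_eq {M : ℕ} (hM : M ≠ 0) :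
    ∑ n ∈ Finset.range (2 * M), (-1 : ℝ) ^ n * (Nat.log 2 n : ℝ) / n =
      ∑ n ∈ Finset.range (2 ^ (Nat.log 2 M + 1)), (1 : ℝ) / n -
        (Nat.log 2 M + 1) * ∑ n ∈ Finset.Ico M (2 * M), (1 : ℝ) / n := by
  have h₁ : 2 ^ (Nat.log 2 M + 1) ≤ 2 * M := by
    have := Nat.pow_log_le_self 2 hM
    rw [pow_succ]; omega
  rw [sum_range_alternating_log_div, sum_Ico_log_div hM, Finset.sum_Ico_eq_sub _ h₁,
    Finset.sum_Ico_eq_sub _ (by omega : M ≤ 2 * M)]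
  ring

theorem sum_Ico_one_div_bounds {M K : ℕ} (hM : 0 < M) (hK : M ≤ K) :
    Real.log K - Real.log M ≤ ∑ n ∈ Finset.Ico M K, (1 : ℝ) / n ∧
      ∑ n ∈ Finset.Ico M K, (1 : ℝ) / n ≤
        Real.log K - Real.log M + (1 / (M : ℝ) - 1 / (K : ℝ)) := by
  induction K, hK using Nat.le_induction with
  | base => simp
  | succ K hK ih =>
    have hK₀ : (0 : ℝ) < K := by exact_mod_cast hM.trans_le hK
    have hlog : Real.log ((K + 1) / K) = Real.log (K + 1) - Real.log K :=
      Real.log_div (by positivity) hK₀.ne'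
    have hup := Real.log_le_sub_one_of_pos (show (0 : ℝ) < (K + 1) / K by positivity)
    have hlow := Real.one_sub_inv_le_log_of_pos (show (0 : ℝ) < (K + 1) / K by positivity)
    have e₁ : ((K : ℝ) + 1) / K - 1 = 1 / K := by field_simp; ring
    have e₂ : 1 - (((K : ℝ) + 1) / K)⁻¹ = 1 / (K + 1) := by field_simp; ring
    rw [Finset.sum_Ico_succ_top hK]
    push_cast
    constructor <;> linarith [ih.1, ih.2]

theorem tendsto_natLog_add_one_div :
    Tendsto (fun M : ℕ => ((Nat.log 2 M : ℝ) + 1) / M) atTop (nhds 0) := by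
  have h₁ : Tendsto (fun M : ℕ => Real.log M / M) atTop (nhds 0) :=
    Real.isLittleO_log_id_atTop.tendsto_div_nhds_zero.comp tendsto_natCast_atTop_atTop
  have h₂ := (h₁.div_const (Real.log 2)).add (tendsto_one_div_atTop_nhds_zero_nat (𝕜 := ℝ))
  simp only [zero_div, add_zero] at h₂
  refine squeeze_zero (fun M => by positivity) (fun M => ?_) h₂
  have h₃ : (Nat.log 2 M : ℝ) ≤ Real.log M / Real.log 2 := by
    simpa [Real.logb] using Real.natLog_le_logb M 2
  calc ((Nat.log 2 M : ℝ) + 1) / M ≤ (Real.log M / Real.log 2 + 1) / M := by gcongr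
    _ = _ := by ring

theorem tendsto_sum_range_two_pow :
    Tendsto (fun k : ℕ => ∑ n ∈ Finset.range (2 ^ k), (1 : ℝ) / n - k * Real.log 2) atTop
      (nhds Real.eulerMascheroniConstant) := by
  have h : Tendsto (fun k : ℕ => 2 ^ k - 1) atTop atTop :=
    (tendsto_sub_atTop_nat 1).comp (tendsto_pow_atTop_atTop_of_one_lt one_lt_two)
  refine (Real.tendsto_eulerMascheroniSeq.comp h).congr fun k => ?_
  have hk : 2 ^ k - 1 + 1 = 2 ^ k := Nat.sub_add_cancel Nat.one_le_two_pow
  have hk' : ((2 ^ k - 1 : ℕ) : ℝ) + 1 = 2 ^ k := by exact_mod_cast hk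
  rw [Function.comp_apply, Real.eulerMascheroniSeq, hk', Real.log_pow]
  nth_rewrite 2 [← hk]
  rw [Finset.sum_range_succ', harmonic]
  simp

theorem tendsto_sum_range_two_mul_alternating_log_div :
    Tendsto (fun M : ℕ => ∑ n ∈ Finset.range (2 * M), (-1 : ℝ) ^ n * (Nat.log 2 n : ℝ) / n) atTop
      (nhds Real.eulerMascheroniConstant) := by
  have hlog : Tendsto (fun M : ℕ => Nat.log 2 M + 1) atTop atTop := by
    refine tendsto_atTop.2 fun b => ?_
    filter_upwards [eventually_ge_atTop (2 ^ b)] with M hM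
    exact (Nat.le_log_of_pow_le one_lt_two hM).trans (Nat.le_succ _)
  have herr : Tendsto (fun M : ℕ => ((Nat.log 2 M : ℝ) + 1) *
      (∑ n ∈ Finset.Ico M (2 * M), (1 : ℝ) / n - Real.log 2)) atTop (nhds 0) := by
    refine squeeze_zero' ?_ ?_ tendsto_natLog_add_one_div <;>
    · filter_upwards [eventually_gt_atTop 0] with M hM
      have hM' : (0 : ℝ) < M := by exact_mod_cast hM
      have hb := sum_Ico_one_div_bounds hM (by omega : M ≤ 2 * M)
      have hl : Real.log ((2 * M : ℕ) : ℝ) = Real.log 2 + Real.log M := by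
        push_cast
        exact Real.log_mul two_ne_zero hM'.ne'
      rw [hl] at hb
      have hpos : 0 ≤ 1 / ((2 * M : ℕ) : ℝ) := by positivity
      first
      | exact mul_nonneg (by positivity) (by linarith [hb.1])
      | rw [div_eq_mul_one_div]
        exact mul_le_mul_of_nonneg_left (by linarith [hb.2]) (by positivity)
  have hmain := (tendsto_sum_range_two_pow.comp hlog).sub herr
  rw [sub_zero] at hmain
  refine hmain.congr' ?_
  filter_upwards [eventually_ne_atTop 0] with M hM
  rw [sum_range_alternating_log_div_eq hM, Function.comp_apply]
  push_cast
  ring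

theorem tendsto_sum_range_alternating_log_div :
    Tendsto (fun N : ℕ => ∑ n ∈ Finset.range N, (-1 : ℝ) ^ n * (Nat.log 2 n : ℝ) / n) atTop
      (nhds Real.eulerMascheroniConstant) := by
  have hhalf : Tendsto (fun N : ℕ => N / 2) atTop atTop :=
    Nat.tendsto_div_const_atTop two_ne_zero
  have hdiff : Tendsto (fun N : ℕ => ∑ n ∈ Finset.range N, (-1 : ℝ) ^ n * (Nat.log 2 n : ℝ) / n -
      ∑ n ∈ Finset.range (2 * (N / 2)), (-1 : ℝ) ^ n * (Nat.log 2 n : ℝ) / n) atTop (nhds 0) := by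
    have hterm : Tendsto (fun M : ℕ => ((Nat.log 2 (2 * M) : ℝ) + 1) / (2 * M : ℕ)) atTop
        (nhds 0) :=
      tendsto_natLog_add_one_div.comp (tendsto_id.const_mul_atTop' two_pos)
    refine squeeze_zero_norm (fun N => ?_) (hterm.comp hhalf)
    rw [Function.comp_apply]
    rcases Nat.even_or_odd' N with ⟨m, rfl | rfl⟩
    · rw [Nat.mul_div_cancel_left _ two_pos, sub_self, norm_zero]
      positivity
    · rw [show (2 * m + 1) / 2 = m by omega, Finset.sum_range_succ, add_sub_cancel_left,
        Even.neg_one_pow (even_two_mul m), one_mul, Real.norm_of_nonneg (by positivity)]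
      gcongr
      linarith
  simpa using hdiff.add (tendsto_sum_range_two_mul_alternating_log_div.comp hhalf)

/-- Vacca's series: `γ = Σ_{n=2}^∞ (-1)^n (N₁(⌊n/2⌋)+N₀(⌊n/2⌋))/n`, interpreted
as the limit of partial sums. Note `N₁(⌊n/2⌋)+N₀(⌊n/2⌋) = ⌊log₂ n⌋` for `n ≥ 2`. -/
theorem vacca_series :
    Tendsto (fun N : ℕ => ∑ n ∈ Finset.Icc 2 N,
        (-1 : ℝ) ^ n *
          (((Nat.digits 2 (n / 2)).count 1 : ℝ) + ((Nat.digits 2 (n / 2)).count 0 : ℝ)) / n)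
      atTop (nhds Real.eulerMascheroniConstant) := by
  refine (tendsto_sum_range_alternating_log_div.comp (tendsto_add_atTop_nat 1)).congr fun N => ?_
  simp only [← Nat.cast_add, Nat.count_digits_two_half, Function.comp_apply]
  symm
  refine Finset.sum_subset (fun n hn => ?_) fun n hn hn' => ?_
  · simp only [Finset.mem_Icc, Finset.mem_range] at hn ⊢
    omega
  · simp only [Finset.mem_Icc, Finset.mem_range] at hn hn'
    have : n < 2 := by omega
    simp [Nat.log_of_lt this]
end

section
/- For every positive integer n, ψ(n) - ∫_{n-1/2}^{n+1/2} ψ(q) dq > 0, where ψ(q) = Γ'(q)/Γ(q) is the digamma function; that is, each summand in the series representation Σ_{n≥1}(ψ(n) - ∫_{n-1/2}^{n+1/2} ψ(q) dq) of γ - ln(4π) + 2 is positive. -/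
open Real Set Filter in
/-- The digamma function is monotone on the positive half-line. -/
theorem monotoneOn_deriv_Gamma_div_Gamma :
    MonotoneOn (fun q : ℝ => deriv Gamma q / Gamma q) (Ioi 0) := by
  have hd : ∀ x ∈ Ioi (0 : ℝ), DifferentiableAt ℝ Gamma x := fun x hx =>
    differentiableOn_Gamma_Ioi.differentiableAt (Ioi_mem_nhds hx)
  have h := convexOn_log_Gamma.monotoneOn_deriv fun x hx =>
    ((hd x hx).log (Gamma_pos_of_pos hx).ne' :)
  refine h.congr fun x hx => ?_
  exact ((hd x hx).hasDerivAt.log (Gamma_pos_of_pos hx).ne').deriv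

open Real Set in
theorem integral_deriv_Gamma_div_Gamma {a b : ℝ} (ha : 0 < a) (hab : a ≤ b) :
    ∫ q in a..b, deriv Gamma q / Gamma q = log (Gamma b) - log (Gamma a) := by
  have hsub : uIcc a b ⊆ Ioi 0 := fun x hx => by
    rw [uIcc_of_le hab] at hx
    exact ha.trans_le hx.1
  refine intervalIntegral.integral_eq_sub_of_hasDerivAt (f := fun q => log (Gamma q))
    (fun x hx => ?_) (monotoneOn_deriv_Gamma_div_Gamma.mono hsub).intervalIntegrable
  exact (differentiableOn_Gamma_Ioi.differentiableAt
    (Ioi_mem_nhds (hsub hx))).hasDerivAt.log (Gamma_pos_of_pos (hsub hx)).ne'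

open Real in
theorem inv_lt_log_add_half_sub_log_sub_half {x : ℝ} (hx : 1 ≤ x) :
    x⁻¹ < log (x + 1 / 2) - log (x - 1 / 2) := by
  have hx0 : 0 < x := by linarith
  have hy : 0 < 1 / (2 * x) := by positivity
  have hy1 : 1 / (2 * x) < 1 := by
    rw [div_lt_one (by positivity)]
    linarith
  have h := sum_range_le_log_div hy.le hy1 2
  have he : (1 + 1 / (2 * x)) / (1 - 1 / (2 * x)) = (x + 1 / 2) / (x - 1 / 2) := by
    rw [div_eq_div_iff (by linarith) (by linarith)]
    field_simp
  rw [he, log_div (by linarith) (by linarith)] at h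
  simp only [Finset.sum_range_succ, Finset.sum_range_zero] at h
  have hc : 0 < (x ^ 3)⁻¹ := by positivity
  norm_num [mul_pow] at h
  linarith

open Real in
theorem strictAnti_harmonic_sub_log_add_half :
    StrictAnti fun m : ℕ => (harmonic m : ℝ) - log (m + 1 / 2) := by
  refine strictAnti_nat_of_succ_lt fun m => ?_
  have h := inv_lt_log_add_half_sub_log_sub_half (x := (m : ℝ) + 1) (by simp)
  rw [show (m : ℝ) + 1 - 1 / 2 = m + 1 / 2 by ring] at h
  rw [harmonic_succ]
  push_cast
  linarith

open Real in
theorem eulerMascheroniConstant_lt_harmonic_sub_log_add_half (m : ℕ) :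
    eulerMascheroniConstant < (harmonic m : ℝ) - log (m + 1 / 2) := by
  refine lt_of_le_of_lt ?_ (strictAnti_harmonic_sub_log_add_half m.lt_succ_self)
  refine le_of_tendsto tendsto_eulerMascheroniSeq ?_
  filter_upwards [Filter.eventually_ge_atTop (m + 1)] with k hk
  refine le_trans ?_ (strictAnti_harmonic_sub_log_add_half.antitone hk)
  have : log ((k : ℝ) + 1 / 2) ≤ log (k + 1) := log_le_log (by positivity) (by linarith)
  simp only [eulerMascheroniSeq]
  linarith

/-- For every positive integer `n`, `ψ(n) - ∫_{n-1/2}^{n+1/2} ψ(q) dq > 0`,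
where `ψ` is the digamma function. -/
theorem digamma_summand_pos (n : ℕ) (hn : 0 < n) :
    0 < deriv Real.Gamma (n : ℝ) / Real.Gamma (n : ℝ) -
      ∫ q in ((n : ℝ) - 1 / 2)..((n : ℝ) + 1 / 2),
        deriv Real.Gamma q / Real.Gamma q := by
  obtain ⟨m, rfl⟩ := Nat.exists_eq_succ_of_ne_zero hn.ne'
  have hm : (0 : ℝ) < m + 1 / 2 := by positivity
  have hG := Real.Gamma_pos_of_pos hm
  have h := eulerMascheroniConstant_lt_harmonic_sub_log_add_half m
  rw [Nat.succ_eq_add_one, Nat.cast_add_one,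
    show (m : ℝ) + 1 - 1 / 2 = m + 1 / 2 by ring,
    show (m : ℝ) + 1 + 1 / 2 = (m + 1 / 2) + 1 by ring,
    integral_deriv_Gamma_div_Gamma hm (by linarith), Real.Gamma_add_one hm.ne',
    Real.log_mul hm.ne' hG.ne', Real.deriv_Gamma_nat, Real.Gamma_nat_eq_factorial,
    mul_div_cancel_left₀ _ (by positivity)]
  linarith
end
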